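/- arXiv:1010.6300 — 2 statements merged into one kernel-verified Lean document; each statement's English description precedes it below -/
import Mathlib

section
/- For every ν ∈ {−1/2, 1/2}, every μ ∈ {0, −1}, and every x with 0 < x ≤ 1, one has | ∑_{k=3}^∞ (−ν)_k (ν+1)_k / ((1−μ)_k · k! · 2^k) · (1−x)^k | ≤ | (−ν)_2 (ν+1)_2 / ((1−μ)_2 · 2! · 2²) | · (1−x)². -/
open Real

/-- The Pochhammer symbol `(a)_k = a(a+1)⋯(a+k−1)`. -/
noncomputable def poch (a : ℝ) (k : ℕ) : ℝ := ∏ i ∈ Finset.range k, (a + i)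

/-- The coefficient `(−ν)_k (ν+1)_k / ((1−μ)_k k! 2^k)` of `(1−x)^k`. -/
noncomputable def seriesCoeff (ν μ : ℝ) (k : ℕ) : ℝ :=
  poch (-ν) k * poch (ν + 1) k / (poch (1 - μ) k * (k.factorial : ℝ) * 2 ^ k)

theorem poch_succ (a : ℝ) (k : ℕ) : poch a (k + 1) = poch a k * (a + k) :=
  Finset.prod_range_succ _ _

theorem seriesCoeff_succ (ν μ : ℝ) (k : ℕ) :
    seriesCoeff ν μ (k + 1) =
      seriesCoeff ν μ k * ((-ν + k) * (ν + 1 + k) / ((1 - μ + k) * (k + 1) * 2)) := by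
  simp only [seriesCoeff, poch_succ, Nat.factorial_succ, pow_succ, Nat.cast_mul, Nat.cast_succ,
    div_mul_div_comm]
  congr 1 <;> ring

theorem abs_seriesCoeff_succ_le {ν μ : ℝ} (hν₁ : -1 ≤ ν) (hν₂ : ν ≤ 1) (hμ : μ ≤ 0)
    {k : ℕ} (hk : 1 ≤ k) : |seriesCoeff ν μ (k + 1)| ≤ |seriesCoeff ν μ k| / 2 := by
  have hk' : (1 : ℝ) ≤ k := by exact_mod_cast hk
  have hden : 0 < (1 - μ + k) * ((k : ℝ) + 1) * 2 := by
    have : 0 < 1 - μ + (k : ℝ) := by linarith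
    positivity
  have hnum : 0 ≤ (-ν + k) * (ν + 1 + k) := mul_nonneg (by linarith) (by linarith)
  rw [seriesCoeff_succ, abs_mul, div_eq_mul_one_div |seriesCoeff ν μ k|]
  refine mul_le_mul_of_nonneg_left ?_ (abs_nonneg _)
  rw [abs_of_nonneg (div_nonneg hnum hden.le), div_le_iff₀ hden]
  nlinarith [sq_nonneg (ν + 1 / 2), mul_nonneg (neg_nonneg.mpr hμ) (by linarith : 0 ≤ (k : ℝ) + 1)]

theorem abs_seriesCoeff_add_three_le {ν μ : ℝ} (hν₁ : -1 ≤ ν) (hν₂ : ν ≤ 1) (hμ : μ ≤ 0)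
    (k : ℕ) : |seriesCoeff ν μ (k + 3)| ≤ |seriesCoeff ν μ 2| / 2 / 2 ^ k := by
  induction k with
  | zero => simpa using abs_seriesCoeff_succ_le hν₁ hν₂ hμ one_le_two
  | succ k ih =>
    calc |seriesCoeff ν μ (k + 3 + 1)| ≤ |seriesCoeff ν μ (k + 3)| / 2 :=
          abs_seriesCoeff_succ_le hν₁ hν₂ hμ (by omega)
      _ ≤ |seriesCoeff ν μ 2| / 2 / 2 ^ k / 2 := by gcongr
      _ = |seriesCoeff ν μ 2| / 2 / 2 ^ (k + 1) := by rw [pow_succ, div_div _ (2 ^ k)]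

theorem tail_estimate (ν μ : ℝ) (hν : ν = -(1/2) ∨ ν = 1/2) (hμ : μ = 0 ∨ μ = -1)
    (x : ℝ) (hx0 : 0 < x) (hx1 : x ≤ 1) :
    |∑' k : ℕ, poch (-ν) (k + 3) * poch (ν + 1) (k + 3) /
        (poch (1 - μ) (k + 3) * ((k + 3).factorial : ℝ) * 2 ^ (k + 3)) * (1 - x) ^ (k + 3)| ≤
      |poch (-ν) 2 * poch (ν + 1) 2 /
          (poch (1 - μ) 2 * ((Nat.factorial 2 : ℕ) : ℝ) * 2 ^ 2)| * (1 - x) ^ 2 := by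
  have hν₁ : -1 ≤ ν := by rcases hν with rfl | rfl <;> norm_num
  have hν₂ : ν ≤ 1 := by rcases hν with rfl | rfl <;> norm_num
  have hμ₀ : μ ≤ 0 := by rcases hμ with rfl | rfl <;> norm_num
  have hy : 0 ≤ 1 - x := by linarith
  have hgeom := (hasSum_geometric_two' |seriesCoeff ν μ 2|).mul_right ((1 - x) ^ 2)
  rw [← Real.norm_eq_abs]
  refine tsum_of_norm_bounded hgeom fun k => ?_
  rw [Real.norm_eq_abs, abs_mul, abs_of_nonneg (pow_nonneg hy _)]
  exact mul_le_mul (abs_seriesCoeff_add_three_le hν₁ hν₂ hμ₀ k)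
    (pow_le_pow_of_le_one hy (by linarith) (by omega)) (pow_nonneg hy _) (by positivity)
end

section
/- For every x with 0 ≤ x ≤ 0.4, one has ∑_{k=0}^∞ [ −Γ(1/4 + k)·Γ(−3/4 + k)/(Γ(1/2 + k)·k!)·x^{2k} + Γ(3/4 + k)·Γ(−1/4 + k)/(Γ(3/2 + k)·k!)·x^{2k+1} ] ≥ 4Γ(1/4)²/(3√π) − (16π^{3/2}/Γ(1/4)²)·x − (Γ(1/4)²/(2√π))·x². -/
open Real

/-- The `k`-th coefficient `Γ(p + k) Γ(q + k) / (Γ(r + k) k!)` of the Gauss hypergeometric series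
with parameters `p`, `q`, `r`, in its Gamma-function normalisation. -/
noncomputable def gammaHypCoeff (p q r : ℝ) (k : ℕ) : ℝ :=
  Real.Gamma (p + k) * Real.Gamma (q + k) / (Real.Gamma (r + k) * (k.factorial : ℝ))

lemma gammaHypCoeff_succ {p q r : ℝ} {k : ℕ} (hp : p + k ≠ 0) (hq : q + k ≠ 0) (hr : r + k ≠ 0) :
    gammaHypCoeff p q r (k + 1) =
      gammaHypCoeff p q r k * ((p + k) * (q + k) / ((r + k) * (k + 1))) := by
  unfold gammaHypCoeff
  have e (s : ℝ) : s + ((k + 1 : ℕ) : ℝ) = s + k + 1 := by push_cast; ring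
  rw [e, e, e, Real.Gamma_add_one hp, Real.Gamma_add_one hq, Real.Gamma_add_one hr,
    Nat.factorial_succ, Nat.cast_mul, Nat.cast_succ, div_mul_div_comm]
  congr 1 <;> ring

lemma abs_gammaHypCoeff_le {p q r : ℝ} (hp : 0 < p) (hpr : p ≤ r) (hq₁ : -1 ≤ q) (hq₂ : q ≤ 1)
    (hq : ∀ k : ℕ, q + k ≠ 0) (k : ℕ) :
    |gammaHypCoeff p q r k| ≤ |gammaHypCoeff p q r 0| := by
  induction k with
  | zero => exact le_rfl
  | succ k ih =>
    have hk : (0 : ℝ) ≤ k := k.cast_nonneg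
    refine le_trans ?_ ih
    rw [gammaHypCoeff_succ (by positivity) (hq k) (by linarith), abs_mul]
    refine mul_le_of_le_one_right (abs_nonneg _) ?_
    rw [abs_div, abs_mul, abs_of_pos (by linarith : 0 < p + k),
      abs_of_pos (mul_pos (by linarith) (by linarith) : 0 < (r + k) * ((k : ℝ) + 1))]
    refine div_le_one_of_le₀ ?_ (mul_nonneg (by linarith) (by linarith))
    exact mul_le_mul (by linarith) (abs_le.2 ⟨by linarith, by linarith⟩) (abs_nonneg _)
      (by linarith)

lemma summable_gammaHypCoeff_mul_pow {p q r x : ℝ} (hp : 0 < p) (hpr : p ≤ r) (hq₁ : -1 ≤ q)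
    (hq₂ : q ≤ 1) (hq : ∀ k : ℕ, q + k ≠ 0) (hx : |x| < 1) :
    Summable fun k : ℕ => gammaHypCoeff p q r k * x ^ (2 * k) := by
  have hx2 : x ^ 2 < 1 := (sq_lt_one_iff_abs_lt_one x).2 hx
  refine Summable.of_norm_bounded
    ((summable_geometric_of_lt_one (sq_nonneg x) hx2).mul_left |gammaHypCoeff p q r 0|) fun k => ?_
  rw [pow_mul, norm_mul, Real.norm_eq_abs, Real.norm_of_nonneg (pow_nonneg (sq_nonneg x) k)]
  exact mul_le_mul_of_nonneg_right (abs_gammaHypCoeff_le hp hpr hq₁ hq₂ hq k)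
    (pow_nonneg (sq_nonneg x) k)

lemma Gamma_add_half_le {s : ℝ} (hs : 0 < s) : Real.Gamma (s + 1 / 2) ≤ √s * Real.Gamma s := by
  have hG := Real.Gamma_pos_of_pos hs
  have h := Real.Gamma_mul_add_mul_le_rpow_Gamma_mul_rpow_Gamma hs (by linarith : 0 < s + 1)
    (by norm_num : (0 : ℝ) < 1 / 2) (by norm_num : (0 : ℝ) < 1 / 2) (by norm_num)
  rw [← Real.sqrt_eq_rpow, ← Real.sqrt_eq_rpow, Real.Gamma_add_one hs.ne', Real.sqrt_mul hs.le,
    mul_left_comm, Real.mul_self_sqrt hG.le] at h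
  convert h using 2
  ring

lemma gammaHypCoeff_even_le_odd (k : ℕ) :
    gammaHypCoeff (1 / 4) (-(3 / 4)) (1 / 2) (k + 2) ≤
      gammaHypCoeff (3 / 4) (-(1 / 4)) (3 / 2) (k + 1) := by
  unfold gammaHypCoeff
  have hk : (0 : ℝ) ≤ k := k.cast_nonneg
  have e₁ : (1 / 4 : ℝ) + ((k + 2 : ℕ) : ℝ) = (k + 7 / 4) + 1 / 2 := by push_cast; ring
  have e₂ : -(3 / 4 : ℝ) + ((k + 2 : ℕ) : ℝ) = (k + 3 / 4) + 1 / 2 := by push_cast; ring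
  have e₃ : (1 / 2 : ℝ) + ((k + 2 : ℕ) : ℝ) = k + 5 / 2 := by push_cast; ring
  have e₄ : (3 / 4 : ℝ) + ((k + 1 : ℕ) : ℝ) = k + 7 / 4 := by push_cast; ring
  have e₅ : -(1 / 4 : ℝ) + ((k + 1 : ℕ) : ℝ) = k + 3 / 4 := by push_cast; ring
  have e₆ : (3 / 2 : ℝ) + ((k + 1 : ℕ) : ℝ) = k + 5 / 2 := by push_cast; ring
  rw [e₁, e₂, e₃, e₄, e₅, e₆, Nat.factorial_succ (k + 1), Nat.cast_mul]
  have h₁ := Gamma_add_half_le (by linarith : (0 : ℝ) < k + 7 / 4)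
  have h₂ := Gamma_add_half_le (by linarith : (0 : ℝ) < k + 3 / 4)
  have g₁ := Real.Gamma_pos_of_pos (by linarith : (0 : ℝ) < k + 7 / 4)
  have g₂ := Real.Gamma_pos_of_pos (by linarith : (0 : ℝ) < k + 3 / 4)
  have g₃ := Real.Gamma_pos_of_pos (by linarith : (0 : ℝ) < k + 5 / 2)
  have g₄ := Real.Gamma_pos_of_pos (by linarith : (0 : ℝ) < (k + 3 / 4) + 1 / 2)
  have hf : (0 : ℝ) < ((k + 1).factorial : ℝ) := by positivity
  have hs : √((k : ℝ) + 7 / 4) * √((k : ℝ) + 3 / 4) ≤ k + 2 := by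
    rw [← Real.sqrt_mul (by linarith)]
    exact Real.sqrt_le_iff.2 ⟨by linarith, by nlinarith⟩
  rw [div_le_div_iff₀ (by positivity) (by positivity)]
  have hm : Real.Gamma (k + 7 / 4 + 1 / 2) * Real.Gamma (k + 3 / 4 + 1 / 2) ≤
      (k + 2) * (Real.Gamma (k + 7 / 4) * Real.Gamma (k + 3 / 4)) :=
    calc _ ≤ _ := mul_le_mul h₁ h₂ g₄.le (by positivity)
      _ = √((k : ℝ) + 7 / 4) * √((k : ℝ) + 3 / 4) *
          (Real.Gamma (k + 7 / 4) * Real.Gamma (k + 3 / 4)) := by ring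
      _ ≤ _ := mul_le_mul_of_nonneg_right hs (by positivity)
  calc _ ≤ _ := mul_le_mul_of_nonneg_right hm (by positivity)
    _ = _ := by push_cast; ring

lemma gammaHypCoeff_odd_nonneg (k : ℕ) :
    0 ≤ gammaHypCoeff (3 / 4) (-(1 / 4)) (3 / 2) (k + 1) := by
  have hk : (0 : ℝ) ≤ k := k.cast_nonneg
  unfold gammaHypCoeff
  push_cast
  have g₁ := Real.Gamma_pos_of_pos (by linarith : (0 : ℝ) < 3 / 4 + (k + 1))
  have g₂ := Real.Gamma_pos_of_pos (by linarith : (0 : ℝ) < -(1 / 4) + (k + 1))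
  have g₃ := Real.Gamma_pos_of_pos (by linarith : (0 : ℝ) < 3 / 2 + (k + 1))
  positivity

lemma Gamma_three_halves : Real.Gamma (3 / 2) = √π / 2 := by
  rw [show (3 / 2 : ℝ) = 1 / 2 + 1 by norm_num, Real.Gamma_add_one (by norm_num),
    Real.Gamma_one_half_eq]
  ring

lemma gammaHypCoeff_even_zero :
    gammaHypCoeff (1 / 4) (-(3 / 4)) (1 / 2) 0 = -(4 * Real.Gamma (1 / 4) ^ 2 / (3 * √π)) := by
  have h := Real.Gamma_add_one (s := -(3 / 4)) (by norm_num)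
  rw [show (-(3 / 4) + 1 : ℝ) = 1 / 4 by norm_num] at h
  have h' : Real.Gamma (-(3 / 4)) = -(4 / 3) * Real.Gamma (1 / 4) := by linarith
  simp only [gammaHypCoeff, Nat.cast_zero, add_zero, Nat.factorial_zero, Nat.cast_one, mul_one,
    h', Real.Gamma_one_half_eq]
  have := Real.sqrt_pos.2 Real.pi_pos
  field_simp

lemma gammaHypCoeff_even_one :
    gammaHypCoeff (1 / 4) (-(3 / 4)) (1 / 2) 1 = Real.Gamma (1 / 4) ^ 2 / (2 * √π) := by
  rw [gammaHypCoeff_succ (by norm_num) (by norm_num) (by norm_num), gammaHypCoeff_even_zero]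
  have := Real.sqrt_pos.2 Real.pi_pos
  push_cast
  field_simp
  norm_num

lemma gammaHypCoeff_odd_zero :
    gammaHypCoeff (3 / 4) (-(1 / 4)) (3 / 2) 0 =
      -(16 * π ^ ((3 : ℝ) / 2) / Real.Gamma (1 / 4) ^ 2) := by
  have h := Real.Gamma_add_one (s := -(1 / 4)) (by norm_num)
  rw [show (-(1 / 4) + 1 : ℝ) = 3 / 4 by norm_num] at h
  have h' : Real.Gamma (-(1 / 4)) = -4 * Real.Gamma (3 / 4) := by linarith
  have hG : 0 < Real.Gamma (1 / 4) := Real.Gamma_pos_of_pos (by norm_num)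
  have hpi := Real.sqrt_pos.2 Real.pi_pos
  have hsq : √π ^ 2 = π := Real.sq_sqrt Real.pi_pos.le
  have hr := Real.Gamma_mul_Gamma_one_sub (1 / 4)
  rw [show (1 - 1 / 4 : ℝ) = 3 / 4 by norm_num, show π * (1 / 4) = π / 4 by ring,
    Real.sin_pi_div_four] at hr
  have h2 : (√2 : ℝ) ^ 2 = 2 := Real.sq_sqrt (by norm_num)
  have h2' : (0 : ℝ) < √2 := by positivity
  have hr2 : Real.Gamma (1 / 4) ^ 2 * Real.Gamma (3 / 4) ^ 2 = 2 * π ^ 2 := by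
    rw [← mul_pow, hr, div_pow, div_pow, h2]
    ring
  have hp : π ^ ((3 : ℝ) / 2) = π * √π := by
    rw [show (3 : ℝ) / 2 = 1 + 1 / 2 by norm_num, Real.rpow_add Real.pi_pos, Real.rpow_one,
      Real.sqrt_eq_rpow]
  simp only [gammaHypCoeff, Nat.cast_zero, add_zero, Nat.factorial_zero, Nat.cast_one, mul_one,
    h', Gamma_three_halves, hp]
  rw [← neg_div, div_eq_div_iff (by positivity) (by positivity)]
  linear_combination -4 * hr2 + 8 * π * hsq

lemma le_tsum_of_even_le_odd {a b : ℕ → ℝ} {x : ℝ} (hx0 : 0 ≤ x) (hx1 : x ≤ 1)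
    (hA : Summable fun k : ℕ => a k * x ^ (2 * k)) (hB : Summable fun k : ℕ => b k * x ^ (2 * k))
    (hab : ∀ k, a (k + 2) ≤ b (k + 1)) (hb : ∀ k, 0 ≤ b (k + 1)) :
    -a 0 + b 0 * x - a 1 * x ^ 2 ≤
      ∑' k : ℕ, (-a k * x ^ (2 * k) + b k * x ^ (2 * k + 1)) := by
  have hB' : Summable fun k : ℕ => b k * x ^ (2 * k + 1) := by
    simpa only [pow_succ, mul_assoc] using hB.mul_right x
  have hA₂ : Summable fun k : ℕ => a (k + 2) * x ^ (2 * (k + 2)) :=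
    hA.comp_injective (add_left_injective 2)
  have hB₁ : Summable fun k : ℕ => b (k + 1) * x ^ (2 * (k + 1) + 1) :=
    hB'.comp_injective (add_left_injective 1)
  have htail : ∑' k : ℕ, a (k + 2) * x ^ (2 * (k + 2)) ≤
      ∑' k : ℕ, b (k + 1) * x ^ (2 * (k + 1) + 1) := by
    refine hA₂.tsum_le_tsum (fun k => ?_) hB₁
    have hx : x ^ (2 * (k + 2)) ≤ x ^ (2 * (k + 1) + 1) :=
      pow_le_pow_of_le_one hx0 hx1 (by omega)
    exact mul_le_mul (hab k) hx (pow_nonneg hx0 _) (hb k)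
  have hAs := hA.sum_add_tsum_nat_add 2
  have hBs := hB'.sum_add_tsum_nat_add 1
  simp only [Finset.sum_range_succ, Finset.sum_range_zero, mul_zero, pow_zero, mul_one, zero_add,
    pow_one] at hAs hBs
  simp only [neg_mul]
  rw [hA.neg.tsum_add hB', tsum_neg]
  linarith

lemma add_natCast_ne_zero_of_quarter {q : ℝ} {m : ℤ} (hm : ¬ (4 : ℤ) ∣ m) (hq : 4 * q = m)
    (k : ℕ) : q + k ≠ 0 := by
  intro h
  refine hm ⟨-k, ?_⟩
  have : (m : ℝ) = 4 * -k := by linarith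
  exact_mod_cast this

theorem P_half_order_neg_one_lower_bound (x : ℝ) (hx0 : 0 ≤ x) (hx : x ≤ 0.4) :
    (∑' k : ℕ,
        (-(Real.Gamma (1/4 + k) * Real.Gamma (-(3/4) + k)) /
            (Real.Gamma (1/2 + k) * (k.factorial : ℝ)) * x ^ (2 * k) +
          Real.Gamma (3/4 + k) * Real.Gamma (-(1/4) + k) /
            (Real.Gamma (3/2 + k) * (k.factorial : ℝ)) * x ^ (2 * k + 1))) ≥
      4 * Real.Gamma (1/4) ^ 2 / (3 * Real.sqrt Real.pi) -
        16 * Real.pi ^ ((3:ℝ)/2) / Real.Gamma (1/4) ^ 2 * x -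
        Real.Gamma (1/4) ^ 2 / (2 * Real.sqrt Real.pi) * x ^ 2 := by
  have hx1 : x < 1 := hx.trans_lt (by norm_num)
  have hxa : |x| < 1 := by rwa [abs_of_nonneg hx0]
  have h := le_tsum_of_even_le_odd hx0 hx1.le
    (summable_gammaHypCoeff_mul_pow (by norm_num) (by norm_num) (by norm_num) (by norm_num)
      (add_natCast_ne_zero_of_quarter (m := -3) (by decide) (by norm_num)) hxa)
    (summable_gammaHypCoeff_mul_pow (by norm_num) (by norm_num) (by norm_num) (by norm_num)
      (add_natCast_ne_zero_of_quarter (m := -1) (by decide) (by norm_num)) hxa)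
    gammaHypCoeff_even_le_odd gammaHypCoeff_odd_nonneg
  rw [gammaHypCoeff_even_zero, gammaHypCoeff_even_one, gammaHypCoeff_odd_zero, neg_neg, neg_mul,
    ← sub_eq_add_neg] at h
  simpa only [gammaHypCoeff, neg_div] using h
end
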